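/- Let D₁,...,Dₙ > 0 and M ≥ 0, and define g(η) = η·Πⱼ(1 - η/(1+Dⱼ))·e^{-Mη} on [0,1]. If Σⱼ 1/Dⱼ + M ≤ 1, then g is nondecreasing on [0,1] and thus attains its maximum at η = 1. -/

import Mathlib

/-- Moving from `x ≤ 1` to `y ≥ x` keeps at least the fraction `1 - (y - x) / d` of the value of
`1 - η / (1 + d)` at `η = x`. -/
lemma one_sub_div_mul_le {d x y : ℝ} (hd : 0 < d) (hx : x ≤ 1) (hxy : x ≤ y) :
    (1 - x / (1 + d)) * (1 - (y - x) * (1 / d)) ≤ 1 - y / (1 + d) := by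
  have h : 1 - y / (1 + d) - (1 - x / (1 + d)) * (1 - (y - x) * (1 / d))
      = (y - x) * (1 - x) / (d * (1 + d)) := by
    field_simp
    ring
  have : 0 ≤ (y - x) * (1 - x) / (d * (1 + d)) :=
    div_nonneg (mul_nonneg (by linarith) (by linarith)) (by positivity)
  linarith

/-- Weierstrass product inequality. -/
lemma one_sub_sum_le_prod_one_sub_of_mem_Icc {ι : Type*} (s : Finset ι) (a : ι → ℝ)
    (h0 : ∀ i ∈ s, 0 ≤ a i) (h1 : ∀ i ∈ s, a i ≤ 1) :
    1 - ∑ i ∈ s, a i ≤ ∏ i ∈ s, (1 - a i) := by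
  induction s using Finset.cons_induction with
  | empty => simp
  | cons i s hi ih =>
    rw [Finset.forall_mem_cons] at h0 h1
    rw [Finset.sum_cons, Finset.prod_cons]
    nlinarith [mul_le_mul_of_nonneg_left (ih h0.2 h1.2) (sub_nonneg.2 h1.1),
      mul_nonneg h0.1 (Finset.sum_nonneg h0.2)]

lemma monotoneOn_throughput {ι : Type*} [Fintype ι] {D : ι → ℝ} {M : ℝ}
    (hD : ∀ j, 0 < D j) (hM : 0 ≤ M) (hcond : (∑ j, 1 / D j) + M ≤ 1) :
    MonotoneOn (fun η : ℝ => η * (∏ j, (1 - η / (1 + D j))) * Real.exp (-(M * η)))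
      (Set.Icc 0 1) := by
  rintro x ⟨hx0, hx1⟩ y ⟨hy0, hy1⟩ hxy
  have hinv : ∀ j, 0 ≤ 1 / D j := fun j => one_div_nonneg.2 (hD j).le
  have hS : 0 ≤ ∑ j, 1 / D j := Finset.sum_nonneg fun j _ => hinv j
  have hd0 : 0 ≤ y - x := sub_nonneg.2 hxy
  have ha0 : ∀ j, 0 ≤ (y - x) * (1 / D j) := fun j => mul_nonneg hd0 (hinv j)
  have ha1 : ∀ j, (y - x) * (1 / D j) ≤ 1 := fun j => by
    have := Finset.single_le_sum (fun i _ => hinv i) (Finset.mem_univ j)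
    exact mul_le_one₀ (by linarith) (hinv j) (by linarith)
  have hf : ∀ j, 0 ≤ 1 - x / (1 + D j) := fun j => by
    have := hD j
    rw [sub_nonneg, div_le_one (by linarith)]
    linarith
  have hP : 0 ≤ ∏ j, (1 - x / (1 + D j)) := Finset.prod_nonneg fun j _ => hf j
  have hprod : (∏ j, (1 - x / (1 + D j))) * (1 - (y - x) * ∑ j, 1 / D j)
      ≤ ∏ j, (1 - y / (1 + D j)) := by
    calc _ ≤ (∏ j, (1 - x / (1 + D j))) * ∏ j, (1 - (y - x) * (1 / D j)) := by
          rw [Finset.mul_sum]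
          exact mul_le_mul_of_nonneg_left (one_sub_sum_le_prod_one_sub_of_mem_Icc _ _
            (fun j _ => ha0 j) fun j _ => ha1 j) hP
      _ ≤ _ := by
          rw [← Finset.prod_mul_distrib]
          exact Finset.prod_le_prod (fun j _ => mul_nonneg (hf j) (sub_nonneg.2 (ha1 j)))
            fun j _ => one_sub_div_mul_le (hD j) hx1 hxy
  have hexp : Real.exp (-(M * x)) * (1 - (y - x) * M) ≤ Real.exp (-(M * y)) := by
    have h := Real.add_one_le_exp (-((y - x) * M))
    calc _ ≤ Real.exp (-(M * x)) * Real.exp (-((y - x) * M)) := by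
          gcongr
          linarith
      _ = _ := by
          rw [← Real.exp_add]
          ring_nf
  have hdS : 0 ≤ 1 - (y - x) * ∑ j, 1 / D j := by nlinarith
  have hdM : 0 ≤ 1 - (y - x) * M := by nlinarith
  have hkey : x ≤ y * ((1 - (y - x) * ∑ j, 1 / D j) * (1 - (y - x) * M)) := by
    have h : 1 - (y - x) ≤ (1 - (y - x) * ∑ j, 1 / D j) * (1 - (y - x) * M) := by
      nlinarith [mul_nonneg (mul_nonneg hd0 hS) (mul_nonneg hd0 hM),
        mul_le_mul_of_nonneg_left hcond hd0]
    nlinarith [mul_le_mul_of_nonneg_left h hy0, mul_nonneg hd0 (sub_nonneg.2 hy1)]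
  have hE := Real.exp_pos (-(M * x))
  calc x * (∏ j, (1 - x / (1 + D j))) * Real.exp (-(M * x))
      ≤ y * ((1 - (y - x) * ∑ j, 1 / D j) * (1 - (y - x) * M))
          * (∏ j, (1 - x / (1 + D j))) * Real.exp (-(M * x)) := by gcongr
    _ = y * ((∏ j, (1 - x / (1 + D j))) * (1 - (y - x) * ∑ j, 1 / D j))
          * (Real.exp (-(M * x)) * (1 - (y - x) * M)) := by ring
    _ ≤ y * (∏ j, (1 - y / (1 + D j))) * Real.exp (-(M * y)) := by
        have := (mul_nonneg hP hdS).trans hprod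
        gcongr

/-- If `∑ j 1/D j + M ≤ 1` (with `D j > 0`, `M ≥ 0`), the throughput
`g(η) = η·∏ j (1-η/(1+D j))·e^{-Mη}` is nondecreasing on `[0,1]` and attains its
maximum at `η = 1`. -/
theorem full_access_optimal (n : ℕ) (D : Fin n → ℝ) (M : ℝ)
    (hD : ∀ j, 0 < D j) (hM : 0 ≤ M)
    (hcond : (∑ j, 1 / D j) + M ≤ 1) :
    MonotoneOn (fun η : ℝ => η * (∏ j, (1 - η / (1 + D j))) * Real.exp (-(M * η)))
      (Set.Icc 0 1) ∧
    (∀ η ∈ Set.Icc (0:ℝ) 1,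
      η * (∏ j, (1 - η / (1 + D j))) * Real.exp (-(M * η))
        ≤ 1 * (∏ j, (1 - 1 / (1 + D j))) * Real.exp (-(M * 1))) := by
  have hmono := monotoneOn_throughput hD hM hcond
  exact ⟨hmono, fun η hη => hmono hη (Set.right_mem_Icc.2 zero_le_one) hη.2⟩
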